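/- Let y ∈ W^K_min, let λ be the Young diagram contained in the k×(n−k) rectangle with vert(λ) = y^{-1}({1,…,k}), and let (J_1,…,J_n) be the Grassmann necklace of y. Then every λ-frozen rectangle occurs in the necklace: for every λ-frozen pair (r,c) there exists an index i ∈ [n] with J_i = Rec(r,c). -/

import Mathlib

/-- `y` fixes every point outside `{1, …, n}`. -/
def fixesOutside (n : ℕ) (y : Equiv.Perm ℕ) : Prop :=
  ∀ i, i ∉ Finset.Icc 1 n → y i = i

/-- `y ∈ W^K_min`: `y⁻¹(1) < ⋯ < y⁻¹(k)` and `y⁻¹(k+1) < ⋯ < y⁻¹(n)`. -/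
def isWKmin (n k : ℕ) (y : Equiv.Perm ℕ) : Prop :=
  fixesOutside n y ∧
  (∀ i j, 1 ≤ i → i < j → j ≤ k → y.symm i < y.symm j) ∧
  (∀ i j, k + 1 ≤ i → i < j → j ≤ n → y.symm i < y.symm j)

/-- `lam` is a Young diagram contained in the `k × (n-k)` rectangle. -/
def isYoung (n k : ℕ) (lam : ℕ → ℕ) : Prop :=
  lam 1 ≤ n - k ∧ ∀ r, 1 ≤ r → r < k → lam (r + 1) ≤ lam r

/-- `vert(λ) = {λ_{k+1−i} + i : 1 ≤ i ≤ k}`. -/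
def vert (k : ℕ) (lam : ℕ → ℕ) : Finset ℕ :=
  (Finset.Icc 1 k).image fun i => lam (k + 1 - i) + i

/-- auxiliary recursion for the Grassmann necklace: `necklaceAux n k y m = J_{m+1}`. -/
def necklaceAux (n k : ℕ) (y : Equiv.Perm ℕ) : ℕ → Finset ℕ
  | 0 => (Finset.Icc 1 n).filter fun i => i < y.symm i ∨ (i ≤ k ∧ y i = i)
  | m + 1 =>
      if m + 1 ∈ necklaceAux n k y m then
        insert (y (m + 1)) ((necklaceAux n k y m).erase (m + 1))
      else necklaceAux n k y m

/-- the Grassmann necklace `J_1, …, J_n` of `y` (1-indexed). -/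
def necklace (n k : ℕ) (y : Equiv.Perm ℕ) (i : ℕ) : Finset ℕ :=
  necklaceAux n k y (i - 1)

/-- `Rec(r,c) = {1,…,k−r} ∪ {k−r+c+1,…,k+c}`, the vertical steps of the `r × c` rectangle. -/
def recSet (k r c : ℕ) : Finset ℕ :=
  Finset.Icc 1 (k - r) ∪ Finset.Icc (k - r + c + 1) (k + c)

/-- Two functions strictly increasing on `{1, …, k}` with the same image satisfy `f ≤ g` there. -/
theorem le_of_strictMonoOn_of_image_eq {k : ℕ} {f g : ℕ → ℕ}
    (hf : StrictMonoOn f (Finset.Icc 1 k)) (hg : StrictMonoOn g (Finset.Icc 1 k))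
    (h : (Finset.Icc 1 k).image f = (Finset.Icc 1 k).image g) {j : ℕ}
    (hj : j ∈ Finset.Icc 1 k) : f j ≤ g j := by
  induction j using Nat.strong_induction_on with
  | _ j ih =>
    obtain ⟨i, hi, hij⟩ := Finset.mem_image.1 (h ▸ Finset.mem_image_of_mem g hj)
    rcases lt_or_ge i j with hlt | hge
    · have h₁ := ih i hlt hi
      have hgi : g i < g j := hg (by simpa using hi) (by simpa using hj) hlt
      omega
    · exact hij ▸ hf.monotoneOn (by simpa using hj) (by simpa using hi) hge

/-- A subset of `(k, n]` closed downwards in `(k, n]` is an initial interval. -/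
theorem eq_Ioc_of_downward_closed {k c : ℕ} {S : Finset ℕ} (hS : ∀ j ∈ S, k < j)
    (hdown : ∀ j ∈ S, ∀ i, k < i → i ≤ j → i ∈ S) (hc : S.card = c) :
    S = Finset.Ioc k (k + c) := by
  apply Finset.eq_of_subset_of_card_le
  · intro j hj
    have hsub : Finset.Ioc k j ⊆ S := fun i hi =>
      hdown j hj i (Finset.mem_Ioc.1 hi).1 (Finset.mem_Ioc.1 hi).2
    have := Finset.card_le_card hsub
    have := hS j hj
    rw [Nat.card_Ioc] at *
    rw [Finset.mem_Ioc]
    omega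
  · simp [hc]

theorem fixesOutside.symm_mem_Icc {n : ℕ} {y : Equiv.Perm ℕ} (hy : fixesOutside n y) {j : ℕ}
    (hj : j ∈ Finset.Icc 1 n) : y.symm j ∈ Finset.Icc 1 n := by
  by_contra h
  have := hy _ h
  rw [Equiv.apply_symm_apply] at this
  exact h (this ▸ hj)

theorem isWKmin.symm_le {n k : ℕ} {y : Equiv.Perm ℕ} (hy : isWKmin n k y) {j : ℕ}
    (hkj : k < j) (hjn : j ≤ n) : y.symm j ≤ j := by
  induction hjn using Nat.decreasingInduction with
  | self =>
    exact (Finset.mem_Icc.1 (hy.1.symm_mem_Icc (Finset.mem_Icc.2 ⟨by omega, le_rfl⟩))).2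
  | of_succ j hj ih =>
    have := ih (by omega)
    have := hy.2.2 j (j + 1) hkj (by omega) hj
    omega

/-- Exactly `m` values in `{1, …, n}` are taken at positions `≤ m`. -/
theorem fixesOutside.card_filter_symm_le {n m : ℕ} {y : Equiv.Perm ℕ} (hy : fixesOutside n y)
    (hm : m ≤ n) : ((Finset.Icc 1 n).filter fun j => y.symm j ≤ m).card = m := by
  have himage : ((Finset.Icc 1 n).filter fun j => y.symm j ≤ m) =
      (Finset.Icc 1 m).map y.toEmbedding := by
    ext j
    simp only [Finset.mem_filter, Finset.mem_map_equiv]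
    constructor
    · rintro ⟨hj, hjm⟩
      have := Finset.mem_Icc.1 (hy.symm_mem_Icc hj)
      exact Finset.mem_Icc.2 ⟨this.1, hjm⟩
    · intro hj
      have hj' := Finset.mem_Icc.1 hj
      refine ⟨?_, hj'.2⟩
      by_contra h
      have hfix : y.symm j = j := by rw [Equiv.symm_apply_eq, hy j h]
      rw [hfix] at hj'
      exact h (Finset.mem_Icc.2 ⟨hj'.1, by omega⟩)
  rw [himage, Finset.card_map, Nat.card_Icc, Nat.add_sub_cancel]

theorem isYoung.antitoneOn {n k : ℕ} {lam : ℕ → ℕ} (hlam : isYoung n k lam) :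
    AntitoneOn lam (Set.Icc 1 k) := by
  intro a ha b hb hab
  induction b, hab using Nat.le_induction with
  | base => exact le_rfl
  | succ b hab ih =>
    exact (hlam.2 b (ha.1.trans hab) hb.2).trans (ih ⟨ha.1.trans hab, (Nat.le_succ b).trans hb.2⟩)

/-- The vertical steps of `λ` are listed in increasing order by `y⁻¹(1), …, y⁻¹(k)`. -/
theorem isWKmin.symm_eq_of_vert_eq {n k : ℕ} {y : Equiv.Perm ℕ} (hy : isWKmin n k y)
    {lam : ℕ → ℕ} (hlam : isYoung n k lam)
    (hvert : vert k lam = (Finset.Icc 1 k).image ⇑y.symm) {j : ℕ} (hj : 1 ≤ j) (hjk : j ≤ k) :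
    y.symm j = lam (k + 1 - j) + j := by
  have hmono : StrictMonoOn (fun i => lam (k + 1 - i) + i) (Finset.Icc 1 k) := by
    intro a ha b hb hab
    rw [Finset.mem_coe, Finset.mem_Icc] at ha hb
    have := hlam.antitoneOn (a := k + 1 - b) (b := k + 1 - a)
      ⟨by omega, by omega⟩ ⟨by omega, by omega⟩ (by omega)
    dsimp only
    omega
  have hsymm : StrictMonoOn ⇑y.symm (Finset.Icc 1 k) := by
    intro a ha b hb hab
    rw [Finset.mem_coe, Finset.mem_Icc] at ha hb
    exact hy.2.1 a b ha.1 hab hb.2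
  have hmem := Finset.mem_Icc.2 ⟨hj, hjk⟩
  exact le_antisymm (le_of_strictMonoOn_of_image_eq hsymm hmono hvert.symm hmem)
    (le_of_strictMonoOn_of_image_eq hmono hsymm hvert hmem)

/-- Closed form of the Grassmann necklace when `j ≤ y⁻¹(j)` for `j ≤ k` and `y⁻¹(j) ≤ j` for
`k < j`. -/
theorem mem_necklaceAux_iff {n k : ℕ} {y : Equiv.Perm ℕ} (hy : fixesOutside n y)
    (hle : ∀ j, 1 ≤ j → j ≤ k → j ≤ y.symm j) (hge : ∀ j, k < j → j ≤ n → y.symm j ≤ j)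
    {m : ℕ} (hm : m ≤ n) (j : ℕ) :
    j ∈ necklaceAux n k y m ↔ (1 ≤ j ∧ j ≤ n) ∧
      ((j ≤ k ∧ (m < j ∨ y.symm j ≤ m)) ∨ (k < j ∧ m < j ∧ y.symm j ≤ m)) := by
  have hpos : ∀ i, 1 ≤ i → i ≤ n → 1 ≤ y.symm i ∧ y.symm i ≤ n := fun i h₁ h₂ =>
    Finset.mem_Icc.1 (hy.symm_mem_Icc (Finset.mem_Icc.2 ⟨h₁, h₂⟩))
  induction m generalizing j with
  | zero =>
    have hfix : y j = j ↔ y.symm j = j := by rw [Equiv.symm_apply_eq, eq_comm]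
    simp only [necklaceAux, Finset.mem_filter, Finset.mem_Icc, hfix]
    have := hle j
    have := hge j
    have := hpos j
    omega
  | succ m ih =>
    have hmn : m ≤ n := by omega
    replace ih := ih hmn
    have heq : j = y (m + 1) ↔ y.symm j = m + 1 := (Equiv.symm_apply_eq y).symm
    have hinj : y.symm j = y.symm (m + 1) ↔ j = m + 1 := y.symm.injective.eq_iff
    have hrange : y.symm j = m + 1 → 1 ≤ j ∧ j ≤ n := by
      intro h
      by_contra hj
      have : y.symm j = j := by
        rw [Equiv.symm_apply_eq, hy j (by rwa [Finset.mem_Icc])]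
      omega
    have := hle j
    have := hge j
    have := hpos j
    have := hle (m + 1)
    have := hge (m + 1)
    rw [necklaceAux]
    split_ifs with h <;> simp only [ih] at h
    · rw [Finset.mem_insert, Finset.mem_erase, heq]
      simp only [ih]
      rcases eq_or_ne j (m + 1) with rfl | hne <;> omega
    · simp only [ih]
      rcases eq_or_ne j (m + 1) with rfl | hne <;> omega

/-- every `λ`-frozen rectangle occurs in the Grassmann necklace of
`y ∈ W^K_min`, where `vert(λ) = y⁻¹({1,…,k})`. -/
theorem every_frozen_rectangle_occurs (n k : ℕ)
    (hn : 2 ≤ n) (hk1 : 1 < k) (hkn : k < n)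
    (y : Equiv.Perm ℕ) (hy : isWKmin n k y)
    (lam : ℕ → ℕ) (hlam : isYoung n k lam)
    (hvert : vert k lam = (Finset.Icc 1 k).image ⇑y.symm) :
    ∀ r c, 1 ≤ r → r ≤ k → 1 ≤ c → c ≤ lam r →
      ¬(r + 1 ≤ k ∧ c + 1 ≤ lam (r + 1)) →
      ∃ i, 1 ≤ i ∧ i ≤ n ∧ necklace n k y i = recSet k r c := by
  intro r c hr hrk hc hcr hfrozen
  have hle : lam r ≤ lam 1 :=
    hlam.antitoneOn ⟨le_rfl, hk1.le⟩ ⟨hr, hrk⟩ hr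
  have hval : ∀ j, 1 ≤ j → j ≤ k → y.symm j = lam (k + 1 - j) + j :=
    fun j => hy.symm_eq_of_vert_eq hlam hvert
  have hmn : k - r + c + 1 ≤ n := by
    have := hlam.1
    omega
  have hlow : ∀ j, 1 ≤ j → j ≤ k → (y.symm j ≤ k - r + c ↔ j ≤ k - r) := by
    have hfirst : k - r + c < y.symm (k - r + 1) := by
      rw [hval _ (by omega) (by omega), show k + 1 - (k - r + 1) = r by omega]
      omega
    have hlast : r < k → y.symm (k - r) ≤ k - r + c := by
      intro h
      rw [hval _ (by omega) (by omega), show k + 1 - (k - r) = r + 1 by omega]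
      omega
    intro j hj hjk
    have h₁ := hy.2.1 j (k - r) hj
    have h₂ := hy.2.1 (k - r + 1) j (by omega)
    rcases lt_trichotomy j (k - r) with h | h | h
    · have := h₁ h (by omega)
      have := hlast (by omega)
      omega
    · subst h
      have := hlast (by omega)
      omega
    · rcases eq_or_ne j (k - r + 1) with rfl | hne
      · omega
      · have := h₂ (by omega) hjk
        omega
  have hhigh : ((Finset.Ioc k n).filter fun j => y.symm j ≤ k - r + c) =
      Finset.Ioc k (k + c) := by
    apply eq_Ioc_of_downward_closed
    · intro j hj
      exact (Finset.mem_Ioc.1 (Finset.mem_filter.1 hj).1).1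
    · intro j hj i hki hij
      rw [Finset.mem_filter, Finset.mem_Ioc] at hj ⊢
      refine ⟨by omega, ?_⟩
      rcases eq_or_lt_of_le hij with rfl | hlt
      · exact hj.2
      · have := hy.2.2 i j hki hlt hj.1.2
        omega
    · have hsplit : ((Finset.Icc 1 n).filter fun j => y.symm j ≤ k - r + c) =
          Finset.Icc 1 (k - r) ∪ (Finset.Ioc k n).filter fun j => y.symm j ≤ k - r + c := by
        ext j
        have := hlow j
        simp only [Finset.mem_filter, Finset.mem_union, Finset.mem_Icc, Finset.mem_Ioc]
        omega
      have hdisj : Disjoint (Finset.Icc 1 (k - r))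
          ((Finset.Ioc k n).filter fun j => y.symm j ≤ k - r + c) := by
        rw [Finset.disjoint_left]
        intro j hj hj'
        rw [Finset.mem_filter, Finset.mem_Ioc] at hj'
        rw [Finset.mem_Icc] at hj
        omega
      have hcard := hy.1.card_filter_symm_le (m := k - r + c) (by omega)
      rw [hsplit, Finset.card_union_of_disjoint hdisj, Nat.card_Icc] at hcard
      omega
  refine ⟨k - r + c + 1, by omega, hmn, ?_⟩
  ext j
  rw [necklace, Nat.add_sub_cancel, mem_necklaceAux_iff hy.1
    (fun i hi hik => by rw [hval i hi hik]; omega) (fun i => hy.symm_le) (by omega),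
    recSet, Finset.mem_union, Finset.mem_Icc, Finset.mem_Icc]
  have hj := Finset.ext_iff.1 hhigh j
  rw [Finset.mem_filter, Finset.mem_Ioc, Finset.mem_Ioc] at hj
  have := hlow j
  omega
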